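/- arXiv:2307.16272 — 2 statements merged into one kernel-verified Lean document; each statement's English description precedes it below -/
import Mathlib

section
/- Let r ≥ 1, d ≥ 1 be integers and let S = (P₁, …, P_{r−1}, I) be a rank r−1 incidence structure. Then the following are equivalent: (a) there exists a characteristic function χ with parameters r, d such that S_χ is equivalent to S; (b) S is equivalent to a rank r−1 incidence structure (P₁, …, P_{r−1}, I′) for which there exist nonempty path-connected compact subsets K_p ⊆ ℝ^{d−1}, one for each p ∈ ⋃ᵢ Pᵢ, such that K_p ∩ K_q = ∅ whenever p ≠ q lie in the same part Pᵢ, and such that for p ∈ Pᵢ, q ∈ Pⱼ with i < j one has (p, q) ∈ I′ if and only if K_p ∩ K_q ≠ ∅. -/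
/-- Two points of `ℕ^d` are *adjacent*: they agree in all but one coordinate,
where they differ by exactly `1`. -/
def GridAdj {d : ℕ} (a b : Fin d → ℕ) : Prop :=
  ∃ j : Fin d, (∀ i : Fin d, i ≠ j → a i = b i) ∧ (a j = b j + 1 ∨ b j = a j + 1)

/-- The connected component of `a` inside the level set `χ⁻¹({χ a})`:
all points reachable from `a` by paths of adjacent points on which `χ` keeps the value `χ a`. -/
def CompOf {d : ℕ} (χ : (Fin d → ℕ) → ℤ) (a : Fin d → ℕ) : Set (Fin d → ℕ) :=
  {b | Relation.ReflTransGen (fun x y => GridAdj x y ∧ χ x = χ a ∧ χ y = χ a) a b}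

/-- `P_χ`: the set of connected components of the level sets `χ⁻¹({r - i})` for `1 ≤ i ≤ r - 1`,
i.e. components of level sets whose value lies in `[1, r-1]`. -/
def Pchi {d : ℕ} (r : ℕ) (χ : (Fin d → ℕ) → ℤ) : Set (Set (Fin d → ℕ)) :=
  {p | ∃ a : Fin d → ℕ, 1 ≤ χ a ∧ χ a ≤ (r : ℤ) - 1 ∧ p = CompOf χ a}

/-- The incidence relation `I_χ` on components: `(p, q) ∈ I_χ` iff `d(p) < d(q)`
(equivalently, the `χ`-value on `p` exceeds that on `q`) and there are adjacent
`a ∈ p`, `b ∈ q` with `a ≤ b`. -/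
def Ichi {d : ℕ} (χ : (Fin d → ℕ) → ℤ) (p q : Set (Fin d → ℕ)) : Prop :=
  ∃ a ∈ p, ∃ b ∈ q, GridAdj a b ∧ a ≤ b ∧ χ b < χ a

/-- A *characteristic function* with parameters `r, d`: `0 ≤ χ ≤ r`, finite support,
and antitone for the componentwise order on `ℕ^d`. -/
def IsCharFun (r d : ℕ) (χ : (Fin d → ℕ) → ℤ) : Prop :=
  (∀ a, 0 ≤ χ a ∧ χ a ≤ (r : ℤ)) ∧ (Function.support χ).Finite ∧
    ∀ a b : Fin d → ℕ, a ≤ b → χ b ≤ χ a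

/-- A rank `kk` incidence structure: a finite set `P` partitioned by the degree map
`deg : P → {1, …, kk}` together with a relation `I` only relating elements of
strictly increasing degree. -/
structure IncStruct (kk : ℕ) where
  P : Type
  finP : Finite P
  deg : P → ℕ
  deg_pos : ∀ p, 1 ≤ deg p
  deg_le : ∀ p, deg p ≤ kk
  I : P → P → Prop
  I_lt : ∀ p q, I p q → deg p < deg q

/-- The incidence structure `S_χ` associated to a characteristic function `χ`
(with parameters `r, d`) is *equivalent* to the incidence structure `S`:
there is a degree-preserving bijection between `P_χ` and `S.P` under which
`I_χ` and `S.I` have the same transitive closure. -/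
def EquivToSchi {d : ℕ} (r : ℕ) (χ : (Fin d → ℕ) → ℤ) {kk : ℕ} (S : IncStruct kk) : Prop :=
  ∃ e : {p : Set (Fin d → ℕ) // p ∈ Pchi r χ} ≃ S.P,
    (∀ p : {p : Set (Fin d → ℕ) // p ∈ Pchi r χ}, ∀ a ∈ p.1,
      (S.deg (e p) : ℤ) = (r : ℤ) - χ a) ∧
    ∀ p q : {p : Set (Fin d → ℕ) // p ∈ Pchi r χ},
      Relation.TransGen
          (fun u v : {p : Set (Fin d → ℕ) // p ∈ Pchi r χ} => Ichi χ u.1 v.1) p q ↔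
        Relation.TransGen S.I (e p) (e q)


section GridLemmas
open Relation

lemma rtg_mono {α : Type*} {r s : α → α → Prop} (h : ∀ x y, r x y → s x y) {a b : α}
    (hab : ReflTransGen r a b) : ReflTransGen s a b := by
  induction hab with
  | refl => exact ReflTransGen.refl
  | tail _ h2 ih => exact ih.tail (h _ _ h2)

lemma rtg_symm {α : Type*} {r : α → α → Prop} (h : ∀ x y, r x y → r y x) {a b : α}
    (hab : ReflTransGen r a b) : ReflTransGen r b a := by
  induction hab with
  | refl => exact ReflTransGen.refl
  | tail _ h2 ih => exact ReflTransGen.head (h _ _ h2) ih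

lemma tg_lift {α β : Type*} {r : α → α → Prop} {s : β → β → Prop} (f : α → β)
    (h : ∀ x y, r x y → TransGen s (f x) (f y)) {a b : α}
    (hab : TransGen r a b) : TransGen s (f a) (f b) := by
  induction hab with
  | single h1 => exact h _ _ h1
  | tail _ h2 ih => exact ih.trans (h _ _ h2)

lemma GridAdj.symm' {d : ℕ} {a b : Fin d → ℕ} (h : GridAdj a b) : GridAdj b a := by
  obtain ⟨j, h1, h2⟩ := h
  exact ⟨j, fun i hi => (h1 i hi).symm, h2.symm⟩

lemma path_up {d : ℕ} (a b : Fin d → ℕ) (h : a ≤ b) :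
    ReflTransGen (fun x y => GridAdj x y ∧ x ≤ y ∧ a ≤ x ∧ y ≤ b) a b := by
  induction hk : ∑ i, b i generalizing b with
  | zero =>
    have : a = b := by
      funext i
      have h1 : b i = 0 := by
        have := Finset.sum_eq_zero_iff.mp hk i (Finset.mem_univ i)
        exact this
      have h2 : a i ≤ b i := h i
      omega
    rw [this]
  | succ k ih =>
    by_cases hab : a = b
    · rw [hab]
    · obtain ⟨j, hj⟩ : ∃ j, a j ≠ b j := by
        by_contra hc
        push Not at hc
        exact hab (funext hc)
      have hlt : a j < b j := lt_of_le_of_ne (h j) hj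
      set b' := Function.update b j (b j - 1) with hb'
      have hle : a ≤ b' := by
        intro i
        by_cases hi : i = j
        · subst hi; simp [hb']; omega
        · simp [hb', hi]; exact h i
      have hle2 : b' ≤ b := by
        intro i
        by_cases hi : i = j
        · subst hi; simp [hb']
        · simp [hb', hi]
      have hsum : ∑ i, b' i = k := by
        have h1 := Finset.sum_update_of_mem (Finset.mem_univ j) b (b j - 1)
        have h2 := Finset.sum_sdiff (f := b) (Finset.subset_univ {j})
        rw [← hb'] at h1
        simp only [Finset.sum_singleton] at h2
        omega
      have p := ih b' hle hsum
      refine ReflTransGen.tail (rtg_mono ?_ p) (⟨⟨j, ?_, ?_⟩, hle2, hle, le_rfl⟩)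
      · rintro x y ⟨q1, q2, q3, q4⟩
        exact ⟨q1, q2, q3, q4.trans hle2⟩
      · intro i hi; simp [hb', hi]
      · right; simp [hb']; omega

lemma comp_val {d : ℕ} {χ : (Fin d → ℕ) → ℤ} {a b : Fin d → ℕ} (h : b ∈ CompOf χ a) :
    χ b = χ a := by
  have h : ReflTransGen (fun x y => GridAdj x y ∧ χ x = χ a ∧ χ y = χ a) a b := h
  cases h with
  | refl => rfl
  | tail _ h => exact h.2.2

lemma comp_self {d : ℕ} (χ : (Fin d → ℕ) → ℤ) (a : Fin d → ℕ) : a ∈ CompOf χ a :=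
  ReflTransGen.refl

lemma comp_symm {d : ℕ} {χ : (Fin d → ℕ) → ℤ} {a b : Fin d → ℕ} (h : b ∈ CompOf χ a) :
    a ∈ CompOf χ b := by
  have hv := comp_val h
  have h : ReflTransGen (fun x y => GridAdj x y ∧ χ x = χ a ∧ χ y = χ a) a b := h
  show ReflTransGen (fun x y => GridAdj x y ∧ χ x = χ b ∧ χ y = χ b) b a
  rw [hv]
  refine rtg_symm ?_ h
  rintro x y ⟨h1, h2, h3⟩
  exact ⟨h1.symm', h3, h2⟩

lemma comp_trans {d : ℕ} {χ : (Fin d → ℕ) → ℤ} {a b c : Fin d → ℕ} (h : b ∈ CompOf χ a)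
    (h' : c ∈ CompOf χ b) : c ∈ CompOf χ a := by
  have hv := comp_val h
  have h1 : ReflTransGen (fun x y => GridAdj x y ∧ χ x = χ a ∧ χ y = χ a) a b := h
  have h2 : ReflTransGen (fun x y => GridAdj x y ∧ χ x = χ b ∧ χ y = χ b) b c := h'
  rw [hv] at h2
  exact h1.trans h2

lemma comp_eq {d : ℕ} {χ : (Fin d → ℕ) → ℤ} {a b : Fin d → ℕ} (h : b ∈ CompOf χ a) :
    CompOf χ b = CompOf χ a := by
  ext c
  exact ⟨fun hc => comp_trans h hc, fun hc => comp_trans (comp_symm h) hc⟩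

lemma comp_of_adj {d : ℕ} {χ : (Fin d → ℕ) → ℤ} {a b : Fin d → ℕ} (h : GridAdj a b)
    (hv : χ a = χ b) : b ∈ CompOf χ a :=
  ReflTransGen.single ⟨h, rfl, hv.symm⟩

lemma comp_of_le {d : ℕ} {χ : (Fin d → ℕ) → ℤ}
    (hχ : ∀ a b : Fin d → ℕ, a ≤ b → χ b ≤ χ a) {a b : Fin d → ℕ} (h : a ≤ b)
    (hv : χ a = χ b) : b ∈ CompOf χ a := by
  refine rtg_mono ?_ (path_up a b h)
  rintro x y ⟨h1, h2, h3, h4⟩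
  have := hχ _ _ h2
  have := hχ _ _ h3
  have := hχ _ _ h4
  exact ⟨h1, by omega, by omega⟩

lemma chain_up {d r : ℕ} {χ : (Fin d → ℕ) → ℤ}
    (hχ : ∀ a b : Fin d → ℕ, a ≤ b → χ b ≤ χ a) {a b : Fin d → ℕ} (h : a ≤ b)
    (ha : CompOf χ a ∈ Pchi r χ) (hb : CompOf χ b ∈ Pchi r χ)
    (h1 : χ a ≤ (r : ℤ) - 1) (h2 : 1 ≤ χ b) :
    ReflTransGen (fun u v : {p : Set (Fin d → ℕ) // p ∈ Pchi r χ} => Ichi χ u.1 v.1)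
      ⟨CompOf χ a, ha⟩ ⟨CompOf χ b, hb⟩ := by
  have key : ∀ y, ReflTransGen (fun x y => GridAdj x y ∧ x ≤ y ∧ a ≤ x ∧ y ≤ b) a y →
      ∀ hy : CompOf χ y ∈ Pchi r χ,
      ReflTransGen (fun u v : {p : Set (Fin d → ℕ) // p ∈ Pchi r χ} => Ichi χ u.1 v.1)
      ⟨CompOf χ a, ha⟩ ⟨CompOf χ y, hy⟩ := by
    intro y hy
    induction hy with
    | refl => intro _; exact ReflTransGen.refl
    | @tail x y hx hxy ih =>
      intro hy
      obtain ⟨q1, q2, q3, q4⟩ := hxy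
      have e1 := hχ _ _ q2
      have e2 := hχ _ _ q3
      have e3 := hχ _ _ q4
      have hxP : CompOf χ x ∈ Pchi r χ := ⟨x, by omega, by omega, rfl⟩
      have ih := ih hxP
      by_cases hc : χ x = χ y
      · have := comp_eq (comp_of_adj q1 hc)
        have h' : (⟨CompOf χ y, hy⟩ : {p : Set (Fin d → ℕ) // p ∈ Pchi r χ})
            = ⟨CompOf χ x, hxP⟩ := Subtype.ext this
        rw [h']; exact ih
      · exact ih.tail ⟨x, comp_self χ x, y, comp_self χ y, q1, q2, by omega⟩
  exact key b (path_up a b h) hb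

lemma chain_up' {d r : ℕ} {χ : (Fin d → ℕ) → ℤ}
    (hχ : ∀ a b : Fin d → ℕ, a ≤ b → χ b ≤ χ a) {a b : Fin d → ℕ} (h : a ≤ b)
    (u v : {p : Set (Fin d → ℕ) // p ∈ Pchi r χ}) (ha : a ∈ u.1) (hb : b ∈ v.1)
    (hlt : χ b < χ a) :
    TransGen (fun u v : {p : Set (Fin d → ℕ) // p ∈ Pchi r χ} => Ichi χ u.1 v.1) u v := by
  obtain ⟨u, hu⟩ := u
  obtain ⟨v, hv⟩ := v
  obtain ⟨a0, ha1, ha2, rfl⟩ := id hu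
  obtain ⟨b0, hb1, hb2, rfl⟩ := id hv
  have ea := comp_val ha
  have eb := comp_val hb
  have ea' := comp_eq ha
  have eb' := comp_eq hb
  have := chain_up (r := r) hχ h (by rw [ea']; exact hu) (by rw [eb']; exact hv)
    (by omega) (by omega)
  simp only [ea', eb'] at this
  rcases reflTransGen_iff_eq_or_transGen.mp this with h | h
  · exfalso
    have h := congrArg Subtype.val h
    simp only at h
    have : b ∈ CompOf χ a0 := by rw [← h]; exact hb
    have := comp_val this
    have := comp_val ha
    omega
  · exact h

end GridLemmas

section Forward
open Relation

/-- Projection along the diagonal direction. -/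
noncomputable def diagProj (n : ℕ) (x : Fin (n + 1) → ℝ) : EuclideanSpace ℝ (Fin n) :=
  WithLp.toLp 2 (fun i => x i.succ - x 0)

lemma continuous_diagProj (n : ℕ) : Continuous (diagProj n) := by
  unfold diagProj
  fun_prop

/-- The projected half-cube at a grid point. -/
noncomputable def pcell {n : ℕ} (a : Fin (n + 1) → ℕ) : Set (EuclideanSpace ℝ (Fin n)) :=
  diagProj n '' Set.Icc (fun i => (a i : ℝ)) (fun i => (a i : ℝ) + 1 / 2)

lemma pcell_compact {n : ℕ} (a : Fin (n + 1) → ℕ) : IsCompact (pcell a) :=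
  isCompact_Icc.image (continuous_diagProj n)

lemma pcell_pathConn {n : ℕ} (a : Fin (n + 1) → ℕ) : IsPathConnected (pcell a) := by
  refine IsPathConnected.image ?_ (continuous_diagProj n)
  refine (convex_Icc _ _).isPathConnected ⟨fun i => (a i : ℝ), le_rfl, ?_⟩
  intro i
  simp

lemma pcell_meet_up {n : ℕ} {a b : Fin (n + 1) → ℕ} (j : Fin (n + 1))
    (h1 : ∀ i, i ≠ j → a i = b i) (h2 : b j = a j + 1) : (pcell a ∩ pcell b).Nonempty := by
  refine ⟨diagProj n (fun i => if i = j then (a i : ℝ) + 1 / 2 else a i),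
    ⟨_, ⟨?_, ?_⟩, rfl⟩, ⟨fun i => if i = j then (b i : ℝ) else (b i : ℝ) + 1 / 2, ⟨?_, ?_⟩, ?_⟩⟩
  · intro i; dsimp only; split_ifs <;> norm_num
  · intro i; dsimp only; split_ifs <;> norm_num
  · intro i; dsimp only; split_ifs <;> norm_num
  · intro i; dsimp only; split_ifs <;> norm_num
  · have key : ∀ i, (if i = j then (b i : ℝ) else (b i : ℝ) + 1 / 2)
        = (if i = j then (a i : ℝ) + 1 / 2 else a i) + 1 / 2 := by
      intro i
      by_cases hi : i = j
      · subst hi; simp [h2]; ring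
      · simp [hi, h1 i hi]
    unfold diagProj
    congr 1
    funext i
    simp only [key]
    ring

lemma pcell_meet {n : ℕ} {a b : Fin (n + 1) → ℕ} (h : GridAdj a b) :
    (pcell a ∩ pcell b).Nonempty := by
  obtain ⟨j, h1, h2 | h2⟩ := h
  · rw [Set.inter_comm]
    exact pcell_meet_up j (fun i hi => (h1 i hi).symm) h2
  · exact pcell_meet_up j h1 h2

lemma pcell_comparable {n : ℕ} {a b : Fin (n + 1) → ℕ} (h : (pcell a ∩ pcell b).Nonempty) :
    a ≤ b ∨ b ≤ a := by
  obtain ⟨z, ⟨x, ⟨hx1, hx2⟩, hx⟩, ⟨y, ⟨hy1, hy2⟩, hy⟩⟩ := h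
  have hd : ∀ i, x i - x 0 = y i - y 0 := by
    intro i
    refine Fin.cases (by simp) (fun i => ?_) i
    have := congrArg (fun w : EuclideanSpace ℝ (Fin n) => w i) (hx.trans hy.symm)
    simpa [diagProj] using this
  have aux : ∀ u v : ℕ, (u : ℝ) ≤ v + 1 / 2 → u ≤ v := by
    intro u v huv
    by_contra hc
    have : (v : ℝ) + 1 ≤ u := by exact_mod_cast Nat.lt_of_not_le hc
    linarith
  rcases le_total (x 0) (y 0) with h0 | h0
  · left
    intro i
    apply aux
    have := hd i; have e1 := hx1 i; have e2 := hy2 i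
    dsimp only at e1 e2
    linarith
  · right
    intro i
    apply aux
    have := hd i; have e1 := hy1 i; have e2 := hx2 i
    dsimp only at e1 e2
    linarith

lemma pcell_union_pathConn {n : ℕ} (χ : (Fin (n + 1) → ℕ) → ℤ) (a : Fin (n + 1) → ℕ) :
    IsPathConnected (⋃ b ∈ CompOf χ a, pcell b) := by
  obtain ⟨x0, hx0⟩ := (pcell_pathConn a).nonempty
  refine ⟨x0, Set.mem_biUnion (comp_self χ a) hx0, ?_⟩
  have key : ∀ b, ReflTransGen (fun x y => GridAdj x y ∧ χ x = χ a ∧ χ y = χ a) a b →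
      ∀ y ∈ pcell b, JoinedIn (⋃ b ∈ CompOf χ a, pcell b) x0 y := by
    intro b hb
    induction hb with
    | refl =>
      intro y hy
      exact ((pcell_pathConn a).joinedIn x0 hx0 y hy).mono
        (Set.subset_biUnion_of_mem (u := fun b => pcell b) (comp_self χ a))
    | @tail b c hb hbc ih =>
      intro y hy
      obtain ⟨z, hz1, hz2⟩ := pcell_meet hbc.1
      have hc : c ∈ CompOf χ a := ReflTransGen.tail hb hbc
      exact (ih z hz1).trans (((pcell_pathConn c).joinedIn z hz2 y hy).mono
        (Set.subset_biUnion_of_mem (u := fun b => pcell b) hc))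
  intro y hy
  obtain ⟨b, hb, hy⟩ := Set.mem_iUnion₂.mp hy
  exact key b hb y hy

theorem forward_dir {r n : ℕ} (S : IncStruct (r - 1))
    (χ : (Fin (n + 1) → ℕ) → ℤ) (hχ : IsCharFun r (n + 1) χ) (hS : EquivToSchi r χ S) :
      ∃ I' : S.P → S.P → Prop,
        (∀ p q, I' p q → S.deg p < S.deg q) ∧
        (∀ p q, Relation.TransGen S.I p q ↔ Relation.TransGen I' p q) ∧
        ∃ K : S.P → Set (EuclideanSpace ℝ (Fin n)),
          (∀ p, (K p).Nonempty ∧ IsPathConnected (K p) ∧ IsCompact (K p)) ∧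
          (∀ p q, p ≠ q → S.deg p = S.deg q → K p ∩ K q = ∅) ∧
          (∀ p q, S.deg p < S.deg q → (I' p q ↔ (K p ∩ K q).Nonempty)) := by
  obtain ⟨-, hfin, hanti⟩ := hχ
  obtain ⟨e, hdeg, hT⟩ := hS
  have hval : ∀ p, ∀ a ∈ (e.symm p).1, (S.deg p : ℤ) = r - χ a := by
    intro p a ha
    have := hdeg (e.symm p) a ha
    simpa using this
  let K : S.P → Set (EuclideanSpace ℝ (Fin n)) := fun p => ⋃ b ∈ (e.symm p).1, pcell b
  have hK : ∀ p q, (K p ∩ K q).Nonempty → ∃ a ∈ (e.symm p).1, ∃ b ∈ (e.symm q).1,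
      a ≤ b ∨ b ≤ a := by
    rintro p q ⟨z, hz1, hz2⟩
    obtain ⟨a, ha, hza⟩ := Set.mem_iUnion₂.mp hz1
    obtain ⟨b, hb, hzb⟩ := Set.mem_iUnion₂.mp hz2
    exact ⟨a, ha, b, hb, pcell_comparable ⟨z, hza, hzb⟩⟩
  have hpc : ∀ p, IsPathConnected (K p) := by
    intro p
    obtain ⟨a, -, -, ha⟩ := (e.symm p).2
    show IsPathConnected (⋃ b ∈ (e.symm p).1, pcell b)
    rw [ha]
    exact pcell_union_pathConn χ a
  refine ⟨fun p q => S.deg p < S.deg q ∧ (K p ∩ K q).Nonempty, fun p q h => h.1, ?_, K, ?_, ?_, ?_⟩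
  · intro p q
    constructor
    · intro h
      have h1 := (hT (e.symm p) (e.symm q)).mpr (by simpa using h)
      have h2 := tg_lift (s := fun p q => S.deg p < S.deg q ∧ (K p ∩ K q).Nonempty) e ?_ h1
      · simpa using h2
      · rintro u v ⟨a, ha, b, hb, hadj, hab, hlt⟩
        refine TransGen.single ⟨?_, ?_⟩
        · have := hdeg u a ha
          have := hdeg v b hb
          omega
        · obtain ⟨z, hz1, hz2⟩ := pcell_meet hadj
          refine ⟨z, Set.mem_biUnion (x := a) ?_ hz1, Set.mem_biUnion (x := b) ?_ hz2⟩
          · simpa using ha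
          · simpa using hb
    · intro h
      refine tg_lift id ?_ h
      rintro p q ⟨hlt, hne⟩
      obtain ⟨a, ha, b, hb, hab⟩ := hK p q hne
      have e1 := hval p a ha
      have e2 := hval q b hb
      have hc : χ b < χ a := by omega
      have hle : a ≤ b := by
        rcases hab with h | h
        · exact h
        · have := hanti _ _ h
          omega
      have := (hT _ _).mp (chain_up' hanti hle (e.symm p) (e.symm q) ha hb hc)
      simpa using this
  · intro p
    refine ⟨(hpc p).nonempty, hpc p, ?_⟩
    refine Set.Finite.isCompact_biUnion (hfin.subset ?_) (fun b _ => pcell_compact b)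
    intro b hb
    obtain ⟨a, ha1, -, ha⟩ := (e.symm p).2
    rw [ha] at hb
    have := comp_val hb
    simp only [Function.mem_support]
    omega
  · intro p q hpq hd
    by_contra hne
    obtain ⟨a, ha, b, hb, hab⟩ := hK p q (Set.nonempty_iff_ne_empty.mpr hne)
    have e1 := hval p a ha
    have e2 := hval q b hb
    have hc : χ a = χ b := by omega
    apply hpq
    have hcomp : ∀ u : {p : Set (Fin (n + 1) → ℕ) // p ∈ Pchi r χ}, ∀ a ∈ u.1,
        u.1 = CompOf χ a := by
      rintro ⟨u, a0, _, _, rfl⟩ a ha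
      exact (comp_eq ha).symm
    have : CompOf χ a = CompOf χ b := by
      rcases hab with h | h
      · exact (comp_eq (comp_of_le hanti h hc)).symm
      · exact comp_eq (comp_of_le hanti h hc.symm)
    apply e.symm.injective
    apply Subtype.ext
    rw [hcomp _ a ha, hcomp _ b hb, this]
  · intro p q h
    exact ⟨fun h => h.2, fun h' => ⟨h, h'⟩⟩

end Forward

section Backward
open Relation

/-- Grid points near a set `K`. -/
def nearGrid {n : ℕ} (K : Set (Fin n → ℝ)) : Set (Fin n → ℕ) :=
  {y | ∃ x ∈ K, ∀ i, |x i - (y i : ℝ)| ≤ 1}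

/-- Adjacency inside a set of grid points. -/
def AdjIn {d : ℕ} (Y : Set (Fin d → ℕ)) (u v : Fin d → ℕ) : Prop :=
  GridAdj u v ∧ u ∈ Y ∧ v ∈ Y

lemma adjIn_symm {d : ℕ} {Y : Set (Fin d → ℕ)} (u v : Fin d → ℕ) (h : AdjIn Y u v) :
    AdjIn Y v u := ⟨h.1.symm', h.2.2, h.2.1⟩

lemma nearGrid_local_le {n : ℕ} {K : Set (Fin n → ℝ)} {x : Fin n → ℝ} (hx : x ∈ K)
    {y z : Fin n → ℕ} (hyz : y ≤ z) (hy : ∀ i, |x i - (y i : ℝ)| ≤ 1)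
    (hz : ∀ i, |x i - (z i : ℝ)| ≤ 1) : ReflTransGen (AdjIn (nearGrid K)) y z := by
  have key : ∀ w, y ≤ w → w ≤ z → w ∈ nearGrid K := by
    intro w h1 h2
    refine ⟨x, hx, fun i => ?_⟩
    have e1 : (y i : ℝ) ≤ w i := by exact_mod_cast h1 i
    have e2 : (w i : ℝ) ≤ z i := by exact_mod_cast h2 i
    have e3 := abs_le.mp (hy i)
    have e4 := abs_le.mp (hz i)
    rw [abs_le]
    constructor <;> linarith
  refine rtg_mono ?_ (path_up y z hyz)
  rintro u v ⟨h1, h2, h3, h4⟩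
  exact ⟨h1, key u h3 (h2.trans h4), key v (h3.trans h2) h4⟩

lemma nearGrid_local {n : ℕ} {K : Set (Fin n → ℝ)} {x : Fin n → ℝ} (hx : x ∈ K)
    {y z : Fin n → ℕ} (hy : ∀ i, |x i - (y i : ℝ)| ≤ 1)
    (hz : ∀ i, |x i - (z i : ℝ)| ≤ 1) : ReflTransGen (AdjIn (nearGrid K)) y z := by
  have hs : ∀ i, |x i - ((y ⊔ z) i : ℝ)| ≤ 1 := by
    intro i
    rcases le_total (y i) (z i) with h | h
    · have : (y ⊔ z) i = z i := by simp [h]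
      rw [this]; exact hz i
    · have : (y ⊔ z) i = y i := by simp [h]
      rw [this]; exact hy i
  exact (nearGrid_local_le hx le_sup_left hy hs).trans
    (rtg_symm adjIn_symm (nearGrid_local_le hx le_sup_right hz hs))

lemma nearGrid_conn {n : ℕ} {K : Set (Fin n → ℝ)} (hK : IsPreconnected K)
    (h0 : ∀ x ∈ K, ∀ i, 0 ≤ x i) {y z : Fin n → ℕ} (hy : y ∈ nearGrid K) (hz : z ∈ nearGrid K) :
    ReflTransGen (AdjIn (nearGrid K)) y z := by
  obtain ⟨x, hx, hxy⟩ := hy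
  obtain ⟨x', hx', hxz⟩ := hz
  have main := hK.induction₂ (fun u v => ∀ y z : Fin n → ℕ, (∀ i, |u i - (y i : ℝ)| ≤ 1) →
    (∀ i, |v i - (z i : ℝ)| ≤ 1) → ReflTransGen (AdjIn (nearGrid K)) y z) ?_ ?_ ?_ hx hx'
  · exact main y z hxy hxz
  · intro u hu
    have hball : Metric.ball u (1 / 2) ∈ nhdsWithin u K :=
      mem_nhdsWithin_of_mem_nhds (Metric.ball_mem_nhds u (by norm_num))
    filter_upwards [hball, self_mem_nhdsWithin] with v hv hvK
    intro y z hy hz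
    have hw : ∀ i, |u i - ((⌊u i + 1 / 2⌋₊ : ℕ) : ℝ)| ≤ 1 / 2 := by
      intro i
      have e0 := h0 u hu i
      have e1 := Nat.floor_le (show 0 ≤ u i + 1 / 2 by linarith)
      have e2 := Nat.lt_floor_add_one (u i + 1 / 2)
      rw [abs_le]; constructor <;> linarith
    have hvu : ∀ i, |v i - u i| ≤ 1 / 2 := by
      intro i
      have h1 := dist_le_pi_dist v u i
      rw [Real.dist_eq] at h1
      exact h1.trans (le_of_lt hv)
    refine (nearGrid_local (z := fun i => ⌊u i + 1 / 2⌋₊) hu hy ?_).trans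
      (nearGrid_local hvK ?_ hz)
    · intro i
      exact (hw i).trans (by norm_num)
    · intro i
      have e1 := abs_le.mp (hw i)
      have e2 := abs_le.mp (hvu i)
      rw [abs_le]; constructor <;> linarith
  · intro a b c ha hb hc h1 h2 y z hy hz
    have hw : ∀ i, |b i - ((⌊b i⌋₊ : ℕ) : ℝ)| ≤ 1 := by
      intro i
      have e1 := Nat.floor_le (h0 b hb i)
      have e2 := Nat.lt_floor_add_one (b i)
      rw [abs_le]; constructor <;> linarith
    exact (h1 y _ hy hw).trans (h2 _ z hw hz)
  · intro a b ha hb h y z hy hz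
    exact rtg_symm adjIn_symm (h z y hz hy)

/-- The generators of the region attached to `K` at height `k`. -/
def genSet {n : ℕ} (M k : ℕ) (Y : Set (Fin n → ℕ)) : Set (Fin (n + 1) → ℕ) :=
  {a | (fun i => a (Fin.succ i)) ∈ Y ∧ (∑ i, a i = M + 2 * k ∨ ∑ i, a i = M + 2 * k + 1)}

/-- Lift of a grid point to a prescribed coordinate sum. -/
def liftPt {n : ℕ} (s : ℕ) (y : Fin n → ℕ) : Fin (n + 1) → ℕ := Fin.cons (s - ∑ i, y i) y

lemma liftPt_sum {n : ℕ} {s : ℕ} {y : Fin n → ℕ} (h : ∑ i, y i ≤ s) :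
    ∑ i, liftPt s y i = s := by
  rw [Fin.sum_univ_succ]
  simp [liftPt]
  omega

lemma liftPt_eq {n : ℕ} {s : ℕ} {a : Fin (n + 1) → ℕ} (h : ∑ i, a i = s) :
    liftPt s (fun i => a (Fin.succ i)) = a := by
  rw [Fin.sum_univ_succ] at h
  funext i
  refine Fin.cases ?_ (fun i => ?_) i
  · simp [liftPt]; omega
  · simp [liftPt]

lemma liftPt_mem {n M k : ℕ} {Y : Set (Fin n → ℕ)} {y : Fin n → ℕ} (hy : y ∈ Y)
    (hM : ∀ y ∈ Y, ∑ i, y i ≤ M) (t : ℕ) (ht : t ≤ 1) :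
    liftPt (M + 2 * k + t) y ∈ genSet M k Y := by
  have := hM y hy
  refine ⟨by simpa [liftPt] using hy, ?_⟩
  rw [liftPt_sum (by omega)]
  omega

lemma gen_step {n M k : ℕ} {Y : Set (Fin n → ℕ)} (hM : ∀ y ∈ Y, ∑ i, y i ≤ M)
    {y : Fin n → ℕ} (hy : y ∈ Y) :
    AdjIn (genSet M k Y) (liftPt (M + 2 * k + 0) y) (liftPt (M + 2 * k + 1) y) := by
  refine ⟨⟨0, ?_, Or.inr ?_⟩, liftPt_mem hy hM 0 (by omega), liftPt_mem hy hM 1 le_rfl⟩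
  · intro i hi
    obtain ⟨i, rfl⟩ := Fin.exists_succ_eq.mpr hi
    simp [liftPt]
  · have := hM y hy
    simp [liftPt]; omega

lemma gen_step_up {n M k : ℕ} {Y : Set (Fin n → ℕ)} (hM : ∀ y ∈ Y, ∑ i, y i ≤ M)
    {y z : Fin n → ℕ} (hy : y ∈ Y) (hz : z ∈ Y) (j : Fin n)
    (h1 : ∀ i, i ≠ j → y i = z i) (h2 : z j = y j + 1) :
    ReflTransGen (AdjIn (genSet M k Y)) (liftPt (M + 2 * k + 0) y) (liftPt (M + 2 * k + 0) z) := by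
  have hsum : ∑ i, z i = ∑ i, y i + 1 := by
    have hz' : z = Function.update y j (y j + 1) := by
      funext i
      by_cases hi : i = j
      · subst hi; simp [h2]
      · simp [hi, h1 i hi]
    have e1 := Finset.sum_update_of_mem (Finset.mem_univ j) y (y j + 1)
    have e2 := Finset.sum_sdiff (f := y) (Finset.subset_univ {j})
    rw [← hz'] at e1
    simp only [Finset.sum_singleton] at e2
    omega
  have e3 := hM y hy
  have e4 := hM z hz
  refine ReflTransGen.tail (ReflTransGen.single (b := liftPt (M + 2 * k + 1) z) ?_)
    (adjIn_symm _ _ (gen_step hM hz))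
  refine ⟨⟨j.succ, ?_, Or.inr ?_⟩, liftPt_mem hy hM 0 (by omega), liftPt_mem hz hM 1 le_rfl⟩
  · intro i
    refine Fin.cases ?_ (fun i => ?_) i
    · intro _; simp [liftPt]; omega
    · intro hi
      simp only [liftPt, Fin.cons_succ]
      exact h1 i (fun h => hi (by rw [h]))
  · simp [liftPt, h2]

lemma gen_conn {n M k : ℕ} {Y : Set (Fin n → ℕ)} (hM : ∀ y ∈ Y, ∑ i, y i ≤ M)
    (hY : ∀ y ∈ Y, ∀ z ∈ Y, ReflTransGen (AdjIn Y) y z) {a b : Fin (n + 1) → ℕ}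
    (ha : a ∈ genSet M k Y) (hb : b ∈ genSet M k Y) :
    ReflTransGen (AdjIn (genSet M k Y)) a b := by
  have base : ∀ a ∈ genSet M k Y, ReflTransGen (AdjIn (genSet M k Y))
      (liftPt (M + 2 * k + 0) (fun i => a (Fin.succ i))) a := by
    intro a ha
    rcases ha.2 with h | h
    · have := liftPt_eq h
      rw [add_zero, this]
    · have := gen_step (k := k) hM ha.1
      rw [liftPt_eq h] at this
      exact ReflTransGen.single this
  have mid : ∀ y z, ReflTransGen (AdjIn Y) y z → ReflTransGen (AdjIn (genSet M k Y))
      (liftPt (M + 2 * k + 0) y) (liftPt (M + 2 * k + 0) z) := by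
    intro y z h
    induction h with
    | refl => exact ReflTransGen.refl
    | tail _ h2 ih =>
      refine ih.trans ?_
      obtain ⟨⟨j, h3, h4⟩, h5, h6⟩ := h2
      rcases h4 with h4 | h4
      · exact rtg_symm adjIn_symm (gen_step_up hM h6 h5 j (fun i hi => (h3 i hi).symm) h4)
      · exact gen_step_up hM h5 h6 j h3 h4
  exact ((rtg_symm adjIn_symm (base a ha)).trans (mid _ _ (hY _ ha.1 _ hb.1))).trans (base b hb)

end Backward

section Core
open Relation

theorem backward_core {r n : ℕ} (hr : 1 ≤ r) (S : IncStruct (r - 1))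
    (K : S.P → Set (Fin n → ℝ)) (B : ℕ) (hne : ∀ p, (K p).Nonempty)
    (hconn : ∀ p, IsPreconnected (K p))
    (hB : ∀ p, ∀ x ∈ K p, ∀ i, 0 ≤ x i ∧ x i ≤ B)
    (hsep : ∀ p q, ∀ x ∈ K p, ∀ y ∈ K q, (∀ i, |x i - y i| ≤ 4 * r + 3) → (K p ∩ K q).Nonempty)
    (hdisj : ∀ p q, p ≠ q → S.deg p = S.deg q → ¬ (K p ∩ K q).Nonempty)
    (hT : ∀ p q, TransGen S.I p q ↔
      TransGen (fun p q => S.deg p < S.deg q ∧ (K p ∩ K q).Nonempty) p q) :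
    ∃ χ : (Fin (n + 1) → ℕ) → ℤ, IsCharFun r (n + 1) χ ∧ EquivToSchi r χ S := by
  classical
  have := S.finP
  have := Fintype.ofFinite S.P
  set M : ℕ := n * (B + 1) with hMdef
  have hM : ∀ p, ∀ y ∈ nearGrid (K p), ∑ i, y i ≤ M := by
    rintro p y ⟨x, hx, hxy⟩
    have : ∀ i ∈ Finset.univ, y i ≤ B + 1 := by
      intro i _
      have e1 := abs_le.mp (hxy i)
      have e2 := (hB p x hx i).2
      have : (y i : ℝ) ≤ ((B + 1 : ℕ) : ℝ) := by push_cast; linarith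
      exact_mod_cast this
    have := Finset.sum_le_card_nsmul _ _ _ this
    simpa using this
  let G : S.P → Set (Fin (n + 1) → ℕ) := fun p => genSet M (S.deg p) (nearGrid (K p))
  have hGsum : ∀ p, ∀ g ∈ G p, M + 2 * S.deg p ≤ ∑ i, g i ∧ ∑ i, g i ≤ M + 2 * S.deg p + 1 := by
    intro p g hg
    rcases hg.2 with h | h <;> omega
  have hd1 := S.deg_pos
  have hd2 := S.deg_le
  let c : (Fin (n + 1) → ℕ) → ℕ := fun a => if ∑ i, a i ≤ M + 1 then r else
    (Finset.univ.filter (fun p => ∃ g ∈ G p, a ≤ g)).sup (fun p => r - S.deg p)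
  have hc1 : ∀ a, ∑ i, a i ≤ M + 1 → c a = r := fun a h => if_pos h
  have hc2 : ∀ a, ¬ ∑ i, a i ≤ M + 1 → c a =
    (Finset.univ.filter (fun p => ∃ g ∈ G p, a ≤ g)).sup (fun p => r - S.deg p) :=
    fun a h => if_neg h
  have hsupr : ∀ s : Finset S.P, s.sup (fun p => r - S.deg p) ≤ r :=
    fun s => Finset.sup_le (fun p _ => Nat.sub_le _ _)
  have hcr : ∀ a, c a ≤ r := by
    intro a
    by_cases h : ∑ i, a i ≤ M + 1
    · rw [hc1 a h]
    · rw [hc2 a h]; exact hsupr _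
  have hcanti : ∀ a b, a ≤ b → c b ≤ c a := by
    intro a b hab
    have hs : ∑ i, a i ≤ ∑ i, b i := Finset.sum_le_sum (fun i _ => hab i)
    by_cases h : ∑ i, a i ≤ M + 1
    · rw [hc1 a h]; exact hcr b
    · rw [hc2 a h, hc2 b (by omega)]
      apply Finset.sup_mono
      intro p hp
      simp only [Finset.mem_filter, Finset.mem_univ, true_and] at hp ⊢
      obtain ⟨g, hg, hbg⟩ := hp
      exact ⟨g, hg, hab.trans hbg⟩
  let V : S.P → Set (Fin (n + 1) → ℕ) := fun p =>
    {a | M + 1 < ∑ i, a i ∧ (∃ g ∈ G p, a ≤ g) ∧ c a = r - S.deg p}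
  have hattain : ∀ a, M + 1 < ∑ i, a i → 1 ≤ c a → ∃ p, a ∈ V p := by
    intro a h1 h2
    have h3 := hc2 a (by omega)
    have hn : (Finset.univ.filter (fun p => ∃ g ∈ G p, a ≤ g)).Nonempty := by
      rw [Finset.nonempty_iff_ne_empty]
      intro h
      rw [h, Finset.sup_empty] at h3
      simp at h3
      omega
    obtain ⟨p, hp, hp2⟩ := Finset.exists_mem_eq_sup _ hn (fun p => r - S.deg p)
    simp only [Finset.mem_filter, Finset.mem_univ, true_and] at hp
    exact ⟨p, h1, hp, by rw [h3, hp2]⟩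
  have hcover : ∀ a, 1 ≤ c a → c a < r → ∃ p, a ∈ V p := by
    intro a h1 h2
    refine hattain a ?_ h1
    by_contra h
    have := hc1 a (by omega)
    omega
  have hGV : ∀ p, G p ⊆ V p := by
    intro p g hg
    have h1 := hGsum p g hg
    have h2 := hd1 p
    have h3 := hd2 p
    have h4 : M + 1 < ∑ i, g i := by omega
    refine ⟨h4, ⟨g, hg, le_rfl⟩, ?_⟩
    rw [hc2 g (by omega)]
    apply le_antisymm
    · apply Finset.sup_le
      intro q hq
      simp only [Finset.mem_filter, Finset.mem_univ, true_and] at hq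
      obtain ⟨g', hg', hle⟩ := hq
      have h5 := hGsum q g' hg'
      have hs : ∑ i, g i ≤ ∑ i, g' i := Finset.sum_le_sum (fun i _ => hle i)
      omega
    · exact Finset.le_sup (f := fun p => r - S.deg p) (by
        simp only [Finset.mem_filter, Finset.mem_univ, true_and]
        exact ⟨g, hg, le_rfl⟩)
  have hVc : ∀ p, ∀ a ∈ V p, 1 ≤ c a ∧ c a < r ∧ S.deg p + c a = r := by
    intro p a ha
    have h1 := hd1 p
    have h2 := hd2 p
    have h3 := ha.2.2
    omega
  -- points of `V p` project close to `K p`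
  have hVnear : ∀ p, ∀ a ∈ V p, ∃ x ∈ K p, ∀ i : Fin n, |x i - (a i.succ : ℝ)| ≤ 2 * r + 1 := by
    rintro p a ⟨h1, ⟨g, hg, hag⟩, -⟩
    obtain ⟨x, hx, hxg⟩ := hg.1
    refine ⟨x, hx, fun i => ?_⟩
    have h2 := hGsum p g hg
    have h3 := hd2 p
    have hle : g i.succ ≤ a i.succ + 2 * r := by
      have e1 := Finset.sum_sdiff (f := g) (Finset.subset_univ {i.succ})
      have e2 := Finset.sum_sdiff (f := a) (Finset.subset_univ {i.succ})
      have e3 : ∑ j ∈ Finset.univ \ {i.succ}, a j ≤ ∑ j ∈ Finset.univ \ {i.succ}, g j :=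
        Finset.sum_le_sum (fun j _ => hag j)
      simp only [Finset.sum_singleton] at e1 e2
      omega
    have hle' : (g i.succ : ℝ) ≤ a i.succ + 2 * r := by exact_mod_cast hle
    have hge' : (a i.succ : ℝ) ≤ g i.succ := by exact_mod_cast hag i.succ
    have e := abs_le.mp (hxg i)
    dsimp only at e
    rw [abs_le]
    have hr0 : (0 : ℝ) ≤ r := Nat.cast_nonneg r
    constructor <;> linarith
  have hclose : ∀ p q, ∀ a ∈ V p, ∀ b ∈ V q, (∀ i, |(a i : ℝ) - b i| ≤ 1) →
      (K p ∩ K q).Nonempty := by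
    intro p q a ha b hb hab
    obtain ⟨x, hx, hxa⟩ := hVnear p a ha
    obtain ⟨y, hy, hyb⟩ := hVnear q b hb
    refine hsep p q x hx y hy (fun i => ?_)
    have e1 := abs_le.mp (hxa i)
    have e2 := abs_le.mp (hyb i)
    have e3 := abs_le.mp (hab i.succ)
    rw [abs_le]; constructor <;> linarith
  have hadjclose : ∀ a b : Fin (n + 1) → ℕ, GridAdj a b → ∀ i, |(a i : ℝ) - b i| ≤ 1 := by
    rintro a b ⟨j, h1, h2⟩ i
    by_cases hi : i = j
    · subst hi
      rcases h2 with h | h <;> rw [h] <;> push_cast <;> rw [abs_le] <;> constructor <;> linarith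
    · rw [h1 i hi]; simp
  have huniq : ∀ p q, ∀ a ∈ V p, ∀ b ∈ V q, (∀ i, |(a i : ℝ) - b i| ≤ 1) → c a = c b → p = q := by
    intro p q a ha b hb hab hcab
    by_contra hpq
    refine hdisj p q hpq ?_ (hclose p q a ha b hb hab)
    have := hVc p a ha
    have := hVc q b hb
    omega
  have hanti : ∀ a b : Fin (n + 1) → ℕ, a ≤ b → ((c b : ℕ) : ℤ) ≤ ((c a : ℕ) : ℤ) :=
    fun a b h => by exact_mod_cast hcanti a b h
  let χ : (Fin (n + 1) → ℕ) → ℤ := fun a => (c a : ℤ)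
  have hχ : ∀ a, χ a = (c a : ℤ) := fun a => rfl
  have hVcomp : ∀ p, ∀ a ∈ V p, CompOf χ a = V p := by
    intro p a ha
    apply Set.Subset.antisymm
    · intro b hb0
      have hb : ReflTransGen (fun x y => GridAdj x y ∧ χ x = χ a ∧ χ y = χ a) a b := hb0
      clear hb0
      induction hb with
      | refl => exact ha
      | @tail x y _ hxy ih =>
        obtain ⟨h1, h2, h3⟩ := hxy
        have e1 := hVc p a ha
        simp only [hχ] at h2 h3
        obtain ⟨q, hq⟩ := hcover y (by omega) (by omega)
        have := huniq p q x ih y hq (hadjclose x y h1) (by omega)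
        rw [this]; exact hq
    · intro b hb
      obtain ⟨-, ⟨g, hg, hag⟩, h1⟩ := id ha
      obtain ⟨-, ⟨g', hg', hbg⟩, h2⟩ := id hb
      have s1 : g ∈ CompOf χ a := comp_of_le hanti hag (by
        show (c a : ℤ) = (c g : ℤ); rw [h1, (hGV p hg).2.2])
      have s2 : g' ∈ CompOf χ b := comp_of_le hanti hbg (by
        show (c b : ℤ) = (c g' : ℤ); rw [h2, (hGV p hg').2.2])
      have s3 : g' ∈ CompOf χ g := by
        refine rtg_mono ?_ (gen_conn (hM p) (fun y hy z hz =>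
          nearGrid_conn (hconn p) (fun x hx i => (hB p x hx i).1) hy hz) hg hg')
        rintro x y ⟨h1, h2, h3⟩
        refine ⟨h1, ?_, ?_⟩
        · simp only [hχ]; rw [(hGV p h2).2.2, (hGV p hg).2.2]
        · simp only [hχ]; rw [(hGV p h3).2.2, (hGV p hg).2.2]
      exact comp_trans (comp_trans s1 s3) (comp_symm s2)
  have hpt : ∀ p, ∀ x ∈ K p, ∀ i, |x i - ((⌊x i⌋₊ : ℕ) : ℝ)| ≤ 1 := by
    intro p x hx i
    have e1 := Nat.floor_le (hB p x hx i).1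
    have e2 := Nat.lt_floor_add_one (x i)
    rw [abs_le]; constructor <;> linarith
  have hGpt : ∀ p, ∀ x ∈ K p, liftPt (M + 2 * S.deg p + 0) (fun i => ⌊x i⌋₊) ∈ G p :=
    fun p x hx => liftPt_mem (Y := nearGrid (K p)) (y := fun i => ⌊x i⌋₊)
      ⟨x, hx, hpt p x hx⟩ (hM p) 0 (by omega)
  have hVne : ∀ p, (V p).Nonempty := by
    intro p
    obtain ⟨x, hx⟩ := hne p
    exact ⟨_, hGV p (hGpt p x hx)⟩
  have hVP : ∀ p, V p ∈ Pchi r χ := by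
    intro p
    obtain ⟨a, ha⟩ := hVne p
    have := hVc p a ha
    exact ⟨a, by simp only [hχ]; omega, by simp only [hχ]; omega, (hVcomp p a ha).symm⟩
  let f : S.P → {p : Set (Fin (n + 1) → ℕ) // p ∈ Pchi r χ} := fun p => ⟨V p, hVP p⟩
  have hf : Function.Bijective f := by
    constructor
    · intro p q hpq
      have h : V p = V q := congrArg Subtype.val hpq
      obtain ⟨a, ha⟩ := hVne p
      exact huniq p q a ha a (h ▸ ha) (fun i => by simp) rfl
    · rintro ⟨u, a, h1, h2, rfl⟩
      simp only [hχ] at h1 h2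
      obtain ⟨p, hp⟩ := hcover a (by omega) (by omega)
      exact ⟨p, Subtype.ext (hVcomp p a hp).symm⟩
  let e := Equiv.ofBijective f hf
  have hef : ∀ p, e p = f p := fun p => rfl
  refine ⟨χ, ⟨?_, ?_, hanti⟩, e.symm, ?_, ?_⟩
  · intro a
    have := hcr a
    simp only [hχ]
    omega
  · refine (Set.finite_Icc (0 : Fin (n + 1) → ℕ) (fun _ => M + 2 * r + 1)).subset ?_
    intro a ha
    simp only [Function.mem_support, hχ] at ha
    refine ⟨fun i => Nat.zero_le _, fun i => ?_⟩
    have h1 : a i ≤ ∑ i, a i := Finset.single_le_sum (f := a) (fun _ _ => Nat.zero_le _)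
      (Finset.mem_univ i)
    have h2 : ∑ i, a i ≤ M + 2 * r + 1 := by
      by_cases h : ∑ i, a i ≤ M + 1
      · omega
      · obtain ⟨p, -, ⟨g, hg, hag⟩, -⟩ := hattain a (by omega) (by omega)
        have h3 := hGsum p g hg
        have h4 := hd2 p
        have hs : ∑ i, a i ≤ ∑ i, g i := Finset.sum_le_sum (fun i _ => hag i)
        omega
    exact h1.trans h2
  · intro u a ha
    obtain ⟨p, rfl⟩ := e.surjective u
    rw [Equiv.symm_apply_apply]
    have := hVc p a ha
    simp only [hχ]
    omega
  · intro u v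
    obtain ⟨p, rfl⟩ := e.surjective u
    obtain ⟨q, rfl⟩ := e.surjective v
    rw [Equiv.symm_apply_apply, Equiv.symm_apply_apply, hT]
    constructor
    · intro h
      have h2 := tg_lift (s := fun p q => S.deg p < S.deg q ∧ (K p ∩ K q).Nonempty) e.symm ?_ h
      · simpa using h2
      · intro u v huv
        obtain ⟨p, rfl⟩ := e.surjective u
        obtain ⟨q, rfl⟩ := e.surjective v
        rw [Equiv.symm_apply_apply, Equiv.symm_apply_apply]
        obtain ⟨a, ha, b, hb, hadj, hab, hlt⟩ := huv
        have h1 := hVc p a ha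
        have h2 := hVc q b hb
        simp only [hχ] at hlt
        exact TransGen.single ⟨by omega, hclose p q a ha b hb (hadjclose a b hadj)⟩
    · intro h
      refine tg_lift e ?_ h
      rintro p q ⟨hlt, x, hxp, hxq⟩
      have ga := hGV p (hGpt p x hxp)
      have gb := hGV q (hGpt q x hxq)
      refine chain_up' hanti ?_ (e p) (e q) ga gb ?_
      · intro i
        refine Fin.cases ?_ (fun i => ?_) i
        · simp [liftPt]; omega
        · simp [liftPt]
      · have h1 := hVc p _ ga
        have h2 := hVc q _ gb
        omega

end Core

section BackwardDir
open Relation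

lemma exists_sep {n : ℕ} (A C : Set (EuclideanSpace ℝ (Fin n))) (hA : IsCompact A)
    (hC : IsCompact C) : ∀ᶠ ε : ℝ in nhdsWithin 0 (Set.Ioi 0),
      ∀ x ∈ A, ∀ y ∈ C, (∀ i, |x i - y i| ≤ ε) → (A ∩ C).Nonempty := by
  by_cases h : (A ∩ C).Nonempty
  · exact Filter.Eventually.of_forall (fun _ _ _ _ _ _ => h)
  · let φ : EuclideanSpace ℝ (Fin n) → (Fin n → ℝ) := fun x i => x i
    have hφ : Continuous φ := by fun_prop
    have hinj : Function.Injective φ := by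
      intro x y hxy
      ext i
      exact congrFun hxy i
    have hd : Disjoint (φ '' A) (φ '' C) := by
      rw [Set.disjoint_image_iff hinj, Set.disjoint_iff_inter_eq_empty]
      exact Set.not_nonempty_iff_eq_empty.mp h
    obtain ⟨δ, hδ, hlt⟩ := Metric.exists_pos_forall_lt_edist (hA.image hφ)
      (hC.image hφ).isClosed hd
    have hmem : Set.Ioo (0 : ℝ) δ ∈ nhdsWithin (0 : ℝ) (Set.Ioi 0) :=
      Ioo_mem_nhdsGT (by exact_mod_cast hδ)
    filter_upwards [hmem] with ε hε x hx y hy hxy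
    exfalso
    have h1 := hlt _ ⟨x, hx, rfl⟩ _ ⟨y, hy, rfl⟩
    have h2 : dist (φ x) (φ y) ≤ ε := by
      rw [dist_pi_le_iff hε.1.le]
      intro i
      rw [Real.dist_eq]
      exact hxy i
    rw [edist_dist, ENNReal.lt_ofReal_iff_toReal_lt (by simp)] at h1
    simp only [ENNReal.coe_toReal] at h1
    linarith [hε.2]

theorem backward_dir {r n : ℕ} (hr : 1 ≤ r) (S : IncStruct (r - 1))
    (I' : S.P → S.P → Prop) (h1 : ∀ p q, I' p q → S.deg p < S.deg q)
    (h2 : ∀ p q, Relation.TransGen S.I p q ↔ Relation.TransGen I' p q)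
    (K : S.P → Set (EuclideanSpace ℝ (Fin n)))
    (h3 : ∀ p, (K p).Nonempty ∧ IsPathConnected (K p) ∧ IsCompact (K p))
    (h4 : ∀ p q, p ≠ q → S.deg p = S.deg q → K p ∩ K q = ∅)
    (h5 : ∀ p q, S.deg p < S.deg q → (I' p q ↔ (K p ∩ K q).Nonempty)) :
    ∃ χ : (Fin (n + 1) → ℕ) → ℤ, IsCharFun r (n + 1) χ ∧ EquivToSchi r χ S := by
  have := S.finP
  obtain ⟨R, hR⟩ : ∃ R : ℕ, ∀ p, ∀ x ∈ K p, ∀ i, |x i| ≤ R := by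
    have hc : IsCompact (⋃ p, K p) := isCompact_iUnion (fun p => (h3 p).2.2)
    obtain ⟨R, hR⟩ := hc.isBounded.exists_norm_le
    obtain ⟨N, hN⟩ := exists_nat_ge R
    refine ⟨N, fun p x hx i => ?_⟩
    have e1 := PiLp.norm_apply_le x i
    rw [Real.norm_eq_abs] at e1
    exact e1.trans ((hR x (Set.mem_iUnion.mpr ⟨p, hx⟩)).trans hN)
  obtain ⟨ε, hε0, hε⟩ : ∃ ε : ℝ, 0 < ε ∧ ∀ p q, ∀ x ∈ K p, ∀ y ∈ K q,
      (∀ i, |x i - y i| ≤ ε) → (K p ∩ K q).Nonempty := by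
    have hev : ∀ᶠ ε : ℝ in nhdsWithin 0 (Set.Ioi 0), ∀ p q, ∀ x ∈ K p, ∀ y ∈ K q,
      (∀ i, |x i - y i| ≤ ε) → (K p ∩ K q).Nonempty :=
      Filter.eventually_all.mpr (fun p => Filter.eventually_all.mpr (fun q =>
        exists_sep _ _ (h3 p).2.2 (h3 q).2.2))
    obtain ⟨ε, hε, hpos⟩ := (hev.and self_mem_nhdsWithin).exists
    exact ⟨ε, hpos, hε⟩
  obtain ⟨N, hN⟩ := exists_nat_ge ((4 * (r : ℝ) + 3) / ε)
  have hNε : 4 * (r : ℝ) + 3 ≤ N * ε := (div_le_iff₀ hε0).mp hN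
  have hr0 : (0 : ℝ) ≤ r := Nat.cast_nonneg r
  have hN0 : (0 : ℝ) < N := by
    by_contra hc
    have : (N : ℝ) * ε ≤ 0 := mul_nonpos_of_nonpos_of_nonneg (not_lt.mp hc) hε0.le
    linarith
  let φ : EuclideanSpace ℝ (Fin n) → (Fin n → ℝ) := fun x i => N * x i + N * R
  have hφ : Continuous φ := by fun_prop
  have hinj : Function.Injective φ := by
    intro x y hxy
    ext i
    have : (N : ℝ) * x i + N * R = N * y i + N * R := congrFun hxy i
    have : (N : ℝ) * x i = N * y i := by linarith
    exact mul_left_cancel₀ hN0.ne' this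
  have hiff : ∀ p q, (φ '' K p ∩ φ '' K q).Nonempty ↔ (K p ∩ K q).Nonempty := by
    intro p q
    rw [← Set.image_inter hinj, Set.image_nonempty]
  refine backward_core hr S (fun p => φ '' K p) (2 * N * R) (fun p => (h3 p).1.image _)
    (fun p => ((h3 p).2.1.isConnected.isPreconnected).image _ hφ.continuousOn) ?_ ?_ ?_ ?_
  · rintro p _ ⟨x, hx, rfl⟩ i
    have e := abs_le.mp (hR p x hx i)
    have e1 : (N : ℝ) * (-R) ≤ N * x i := mul_le_mul_of_nonneg_left e.1 hN0.le
    have e2 : (N : ℝ) * x i ≤ N * R := mul_le_mul_of_nonneg_left e.2 hN0.le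
    show 0 ≤ (N : ℝ) * x i + N * R ∧ (N : ℝ) * x i + N * R ≤ ((2 * N * R : ℕ) : ℝ)
    push_cast
    constructor <;> linarith
  · rintro p q _ ⟨x, hx, rfl⟩ _ ⟨y, hy, rfl⟩ hxy
    rw [hiff]
    refine hε p q x hx y hy (fun i => ?_)
    have e : |((N : ℝ) * x i + N * R) - (N * y i + N * R)| ≤ 4 * r + 3 := hxy i
    have e2 : ((N : ℝ) * x i + N * R) - (N * y i + N * R) = N * (x i - y i) := by ring
    rw [e2, abs_mul, abs_of_pos hN0] at e
    exact le_of_mul_le_mul_left (e.trans hNε) hN0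
  · intro p q hpq hd
    rw [hiff, h4 p q hpq hd]
    exact Set.not_nonempty_empty
  · intro p q
    rw [h2]
    have : I' = fun p q => S.deg p < S.deg q ∧ (φ '' K p ∩ φ '' K q).Nonempty := by
      funext p q
      apply propext
      rw [hiff]
      exact ⟨fun h => ⟨h1 p q h, (h5 p q (h1 p q h)).mp h⟩, fun h => (h5 p q h.1).mpr h.2⟩
    rw [← this]

end BackwardDir

/-- Let `r ≥ 1`, `d ≥ 1` and let `S` be a rank `r−1` incidence structure.
The following are equivalent: (a) there is a characteristic function `χ` with parameters
`r, d` such that `S_χ` is equivalent to `S`; (b) `S` is equivalent to a rank `r−1` incidence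
structure `(P₁, …, P_{r−1}, I′)` (same parts, so having the same transitive closure as `S.I`)
for which there exist nonempty path-connected compact subsets `K_p ⊆ ℝ^{d−1}`, one for each
`p`, with `K_p ∩ K_q = ∅` for distinct `p ≠ q` in the same part, and such that for
`deg p < deg q` one has `(p, q) ∈ I′` iff `K_p ∩ K_q ≠ ∅`. -/
theorem statement4 {r d : ℕ} (hr : 1 ≤ r) (hd : 1 ≤ d) (S : IncStruct (r - 1)) :
    (∃ χ : (Fin d → ℕ) → ℤ, IsCharFun r d χ ∧ EquivToSchi r χ S) ↔
      ∃ I' : S.P → S.P → Prop,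
        (∀ p q, I' p q → S.deg p < S.deg q) ∧
        (∀ p q, Relation.TransGen S.I p q ↔ Relation.TransGen I' p q) ∧
        ∃ K : S.P → Set (EuclideanSpace ℝ (Fin (d - 1))),
          (∀ p, (K p).Nonempty ∧ IsPathConnected (K p) ∧ IsCompact (K p)) ∧
          (∀ p q, p ≠ q → S.deg p = S.deg q → K p ∩ K q = ∅) ∧
          (∀ p q, S.deg p < S.deg q → (I' p q ↔ (K p ∩ K q).Nonempty)) := by
  obtain ⟨n, rfl⟩ : ∃ n, d = n + 1 := ⟨d - 1, by omega⟩
  constructor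
  · rintro ⟨χ, hχ, hS⟩
    exact forward_dir S χ hχ hS
  · rintro ⟨I', h1, h2, K, h3, h4, h5⟩
    exact backward_dir (n := n) hr S I' h1 h2 K h3 h4 h5
end

section
/- A finite simple graph G = (V, E) is the intersection graph of a family (S_v)_{v ∈ V} of subsets of ℝ² each homeomorphic to the closed interval [0,1] (i.e., G is a string graph) if and only if G is the intersection graph of a family (K_v)_{v ∈ V} of nonempty connected compact subsets of ℝ². -/
abbrev Plane := EuclideanSpace ℝ (Fin 2)

theorem local_move (c x : Plane) (r : ℝ) (hr : 0 < r) (hx : x ∈ Metric.ball c r) :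
    ∃ h : Plane ≃ₜ Plane, h c = x ∧ ∀ z, z ∉ Metric.ball c r → h z = z := by
  have hxr : ‖x - c‖ < r := by simpa [dist_eq_norm] using hx
  let m : Plane → ℝ := fun z => max 0 (1 - ‖z - c‖ / r)
  let f : Plane → Plane := fun z => z + m z • (x - c)
  have hm : ∀ z w, |m z - m w| ≤ ‖z - w‖ / r := by
    intro z w
    have h1 : |m z - m w| ≤ |(1 - ‖z - c‖ / r) - (1 - ‖w - c‖ / r)| := by
      have := abs_max_sub_max_le_abs (1 - ‖z - c‖ / r) (1 - ‖w - c‖ / r) 0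
      simpa [m, max_comm] using this
    have h2 : (1 - ‖z - c‖ / r) - (1 - ‖w - c‖ / r) = (‖w - c‖ - ‖z - c‖) / r := by ring
    rw [h2, abs_div, abs_of_pos hr] at h1
    refine h1.trans ?_
    gcongr
    have := abs_norm_sub_norm_le (w - c) (z - c)
    rw [sub_sub_sub_cancel_right, norm_sub_rev w z] at this
    exact this
  let k : NNReal := ⟨‖x - c‖ / r, by positivity⟩
  have hf : ApproximatesLinearOn f
      ((ContinuousLinearEquiv.refl ℝ Plane : Plane ≃L[ℝ] Plane) : Plane →L[ℝ] Plane)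
      Set.univ k := by
    intro z _ w _
    have e : f z - f w - (z - w) = (m z - m w) • (x - c) := by
      simp only [f]; rw [sub_smul]; abel
    have : ‖f z - f w - (z - w)‖ ≤ ‖x - c‖ / r * ‖z - w‖ := by
      rw [e, norm_smul, Real.norm_eq_abs]
      calc |m z - m w| * ‖x - c‖ ≤ ‖z - w‖ / r * ‖x - c‖ := by
            gcongr; exact hm z w
        _ = _ := by ring
    exact this
  have hk : Subsingleton Plane ∨
      k < ‖((ContinuousLinearEquiv.refl ℝ Plane).symm : Plane →L[ℝ] Plane)‖₊⁻¹ := by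
    right
    have h1 : ‖((ContinuousLinearEquiv.refl ℝ Plane).symm : Plane →L[ℝ] Plane)‖₊ = 1 := by
      have : ‖ContinuousLinearMap.id ℝ Plane‖ = 1 := ContinuousLinearMap.norm_id
      exact NNReal.eq this
    rw [h1, inv_one]
    change ‖x - c‖ / r < 1
    rwa [div_lt_one hr]
  refine ⟨hf.toHomeomorph f hk, ?_, ?_⟩
  · change f c = x
    simp [f, m]
  · intro z hz
    change f z = z
    have : r ≤ ‖z - c‖ := by simpa [dist_eq_norm] using hz
    have h2 : 1 - ‖z - c‖ / r ≤ 0 := by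
      rw [sub_nonpos, one_le_div hr]; exact this
    simp [f, m, max_eq_left h2]

theorem move {W : Set Plane} (hW : IsOpen W) (hc : IsPreconnected W) {x y : Plane}
    (hx : x ∈ W) (hy : y ∈ W) :
    ∃ h : Plane ≃ₜ Plane, h x = y ∧ ∀ z, z ∉ W → h z = z := by
  let O : Set Plane := {y | y ∈ W ∧ ∃ h : Plane ≃ₜ Plane, h x = y ∧ ∀ z, z ∉ W → h z = z}
  suffices h : W ⊆ O from (h hy).2
  have key : ∀ y ∈ W, ∃ r > 0, ∀ z ∈ Metric.ball y r, z ∈ W ∧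
      ∃ h : Plane ≃ₜ Plane, h y = z ∧ ∀ z, z ∉ W → h z = z := by
    intro y hy
    obtain ⟨r, hr, hb⟩ := Metric.isOpen_iff.1 hW y hy
    refine ⟨r, hr, fun z hz => ⟨hb hz, ?_⟩⟩
    obtain ⟨h, h1, h2⟩ := local_move y z r hr hz
    exact ⟨h, h1, fun w hw => h2 w fun hw' => hw (hb hw')⟩
  apply hc.subset_of_closure_inter_subset
  · rw [Metric.isOpen_iff]
    rintro y ⟨hy, h, h1, h2⟩
    obtain ⟨r, hr, hb⟩ := key y hy
    refine ⟨r, hr, fun z hz => ?_⟩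
    obtain ⟨hz', g, g1, g2⟩ := hb z hz
    refine ⟨hz', h.trans g, by simp [h1, g1], fun w hw => by simp [h2 w hw, g2 w hw]⟩
  · exact ⟨x, hx, hx, Homeomorph.refl _, rfl, fun _ _ => rfl⟩
  · rintro y ⟨hyc, hy⟩
    obtain ⟨r, hr, hb⟩ := key y hy
    obtain ⟨o, ⟨ho, h, h1, h2⟩, hd⟩ := Metric.mem_closure_iff.1 hyc r hr
    obtain ⟨_, g, g1, g2⟩ := hb o (by rwa [Metric.mem_ball, dist_comm])
    refine ⟨hy, h.trans g.symm, ?_, fun w hw => ?_⟩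
    · simp [h1, ← g1]
    · rw [Homeomorph.trans_apply, h2 w hw, Homeomorph.symm_apply_eq, g2 w hw]

theorem punctured_ball (p : Plane) (r : ℝ) (hr : 0 < r) :
    IsConnected (Metric.ball p r \ {p}) := by
  have h1 : 1 < Module.rank ℝ Plane := by
    apply Module.lt_rank_of_lt_finrank
    simp
  have h2 := isConnected_compl_singleton_of_one_lt_rank h1 (0 : Plane)
  have h3 := h2.image (OpenPartialHomeomorph.univBall p r)
    (OpenPartialHomeomorph.continuous_univBall p r).continuousOn
  convert h3 using 1
  have hs : (OpenPartialHomeomorph.univBall p r).source = Set.univ :=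
    OpenPartialHomeomorph.univBall_source p r
  have ht := OpenPartialHomeomorph.univBall_target p hr
  ext z
  constructor
  · rintro ⟨hz, hzp⟩
    rw [← ht] at hz
    refine ⟨(OpenPartialHomeomorph.univBall p r).symm z, ?_,
      (OpenPartialHomeomorph.univBall p r).right_inv hz⟩
    intro h0
    apply hzp
    rw [Set.mem_singleton_iff] at h0
    rw [Set.mem_singleton_iff, ← (OpenPartialHomeomorph.univBall p r).right_inv hz, h0,
      OpenPartialHomeomorph.univBall_apply_zero]
  · rintro ⟨w, hw, rfl⟩
    refine ⟨?_, ?_⟩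
    · rw [← ht]
      exact (OpenPartialHomeomorph.univBall p r).map_source (by simp)
    · intro h
      rw [Set.mem_singleton_iff] at h
      have hw1 : w ∈ (OpenPartialHomeomorph.univBall p r).source := by rw [hs]; trivial
      have hw0 : (0 : Plane) ∈ (OpenPartialHomeomorph.univBall p r).source := by rw [hs]; trivial
      exact hw ((OpenPartialHomeomorph.univBall p r).injOn hw1 hw0
        (h.trans (OpenPartialHomeomorph.univBall_apply_zero p r).symm))

theorem diff_point {U : Set Plane} (hU : IsOpen U) (hc : IsPreconnected U) (p : Plane) :
    IsPreconnected (U \ {p}) := by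
  by_cases hp : p ∈ U
  swap
  · rwa [Set.sdiff_singleton_eq_self hp]
  obtain ⟨r, hr, hb⟩ := Metric.isOpen_iff.1 hU p hp
  have hB := punctured_ball p r hr
  have hBU : Metric.ball p r \ {p} ⊆ U \ {p} := Set.sdiff_subset_sdiff_left hb
  -- if the punctured ball lies in `A`, then `B` misses
  have key : ∀ A B : Set Plane, IsOpen A → IsOpen B → U \ {p} ⊆ A ∪ B →
      Metric.ball p r \ {p} ⊆ A → (U \ {p} ∩ B).Nonempty →
      (U \ {p} ∩ (A ∩ B)).Nonempty := by
    intro A B hA hB' hAB hBA hBn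
    have := hc (A ∪ Metric.ball p r) (B \ {p}) (hA.union Metric.isOpen_ball)
      (hB'.sdiff isClosed_singleton) ?_ ?_ ?_
    · obtain ⟨z, hz, hz1, hz2⟩ := this
      refine ⟨z, ⟨hz, hz2.2⟩, ?_, hz2.1⟩
      rcases hz1 with h | h
      · exact h
      · exact hBA ⟨h, hz2.2⟩
    · intro z hz
      by_cases hzp : z = p
      · left; right; rw [hzp]; exact Metric.mem_ball_self hr
      · rcases hAB ⟨hz, hzp⟩ with h | h
        · exact Or.inl (Or.inl h)
        · exact Or.inr ⟨h, hzp⟩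
    · exact ⟨p, hp, Or.inr (Metric.mem_ball_self hr)⟩
    · obtain ⟨z, hz, hz'⟩ := hBn
      exact ⟨z, hz.1, hz', hz.2⟩
  intro A B hA hB' hAB hAn hBn
  by_cases h1 : (Metric.ball p r \ {p} ∩ B).Nonempty
  · by_cases h2 : (Metric.ball p r \ {p} ∩ A).Nonempty
    · obtain ⟨z, hz, hz'⟩ := hB.isPreconnected A B hA hB' (hBU.trans hAB) h2 h1
      exact ⟨z, hBU hz, hz'⟩
    · have := key B A hB' hA (by rwa [Set.union_comm]) ?_ hAn
      · rwa [Set.inter_comm A B]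
      · intro z hz
        rcases hAB (hBU hz) with h | h
        · exact absurd ⟨z, hz, h⟩ h2
        · exact h
  · refine key A B hA hB' hAB ?_ hBn
    intro z hz
    rcases hAB (hBU hz) with h | h
    · exact h
    · exact absurd ⟨z, hz, h⟩ h1

theorem diff_finite {U : Set Plane} (hU : IsOpen U) (hc : IsPreconnected U) (F : Finset Plane) :
    IsPreconnected (U \ (F : Set Plane)) := by
  classical
  induction F using Finset.induction_on with
  | empty => simpa using hc
  | insert a s _ ih =>
    have := diff_point (hU.sdiff s.finite_toSet.isClosed) ih a
    convert this using 1
    ext z; simp; tauto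

theorem arc_through {U : Set Plane} (hU : IsOpen U) (hc : IsConnected U) (F : Finset Plane)
    (hF : (F : Set Plane) ⊆ U) :
    ∃ γ : Set.Icc (0 : ℝ) 1 → Plane, Continuous γ ∧ Function.Injective γ ∧
      Set.range γ ⊆ U ∧ (F : Set Plane) ⊆ Set.range γ := by
  classical
  induction F using Finset.induction_on with
  | empty =>
    obtain ⟨p, hp⟩ := hc.nonempty
    obtain ⟨r, hr, hb⟩ := Metric.isOpen_iff.1 hU p hp
    obtain ⟨v, hv⟩ := exists_ne (0 : Plane)
    have hv' : 0 < ‖v‖ := norm_pos_iff.2 hv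
    refine ⟨fun t => p + ((t : ℝ) * (r / 2 / ‖v‖)) • v, by fun_prop, ?_, ?_, by simp⟩
    · intro s t hst
      have h1 := smul_left_injective ℝ hv (add_left_cancel hst)
      have h2 : r / 2 / ‖v‖ ≠ 0 := by positivity
      exact Subtype.ext (mul_right_cancel₀ h2 h1)
    · rintro _ ⟨t, rfl⟩
      apply hb
      have h0 := t.2.1
      have h1 := t.2.2
      have e : (t : ℝ) * (r / 2 / ‖v‖) * ‖v‖ = t * (r / 2) := by field_simp
      simp only [Metric.mem_ball, dist_eq_norm, add_sub_cancel_left, norm_smul, Real.norm_eq_abs]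
      rw [abs_of_nonneg (by positivity), e]
      nlinarith
  | insert p s hps ih =>
    have hpU : p ∈ U := hF (by simp)
    have hsU : (s : Set Plane) ⊆ U := fun z hz => hF (by simp at hz; simp [hz])
    obtain ⟨γ, h1, h2, h3, h4⟩ := ih hsU
    have hinf : (Set.range γ).Infinite := by
      have : Infinite (Set.Icc (0 : ℝ) 1) := (Set.Icc_infinite one_pos).to_subtype
      exact Set.infinite_range_of_injective h2
    obtain ⟨q, hq, hqs⟩ := hinf.exists_notMem_finset s
    obtain ⟨h, hh, hid⟩ := move (hU.sdiff s.finite_toSet.isClosed)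
      (diff_finite hU hc.isPreconnected s) (x := q) (y := p) ⟨h3 hq, hqs⟩ ⟨hpU, hps⟩
    refine ⟨h ∘ γ, h.continuous.comp h1, h.injective.comp h2, ?_, ?_⟩
    · rintro _ ⟨t, rfl⟩
      by_contra hn
      have e := h.injective (hid (h (γ t)) fun hw => hn hw.1)
      apply hn
      change h (γ t) ∈ U
      rw [e]
      exact h3 ⟨t, rfl⟩
    · intro z hz
      rw [Finset.coe_insert, Set.mem_insert_iff] at hz
      rcases hz with rfl | hz
      · obtain ⟨t, rfl⟩ := hq
        exact ⟨t, hh⟩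
      · obtain ⟨t, ht⟩ := h4 hz
        refine ⟨t, ?_⟩
        change h (γ t) = z
        rw [ht]
        exact hid z fun hw => hw.2 hz

/-- A finite simple graph `G` is the intersection graph of a family of
subsets of `ℝ²` each homeomorphic to the closed interval `[0,1]` (i.e. `G` is a string
graph) if and only if `G` is the intersection graph of a family of nonempty connected
compact subsets of `ℝ²`. -/
theorem statement9 {V : Type} [Fintype V] (G : SimpleGraph V) :
    (∃ S : V → Set (EuclideanSpace ℝ (Fin 2)),
       (∀ v, Nonempty (↥(Set.Icc (0 : ℝ) 1) ≃ₜ ↥(S v))) ∧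
       ∀ v w, v ≠ w → (G.Adj v w ↔ (S v ∩ S w).Nonempty)) ↔
    (∃ K : V → Set (EuclideanSpace ℝ (Fin 2)),
       (∀ v, (K v).Nonempty ∧ IsConnected (K v) ∧ IsCompact (K v)) ∧
       ∀ v w, v ≠ w → (G.Adj v w ↔ (K v ∩ K w).Nonempty)) := by
  classical
  constructor
  · rintro ⟨S, hS, hadj⟩
    refine ⟨S, fun v => ?_, hadj⟩
    obtain ⟨e⟩ := hS v
    have hconn : IsConnected (S v) := by
      have : ConnectedSpace (Set.Icc (0 : ℝ) 1) :=
        isConnected_iff_connectedSpace.1 (isConnected_Icc zero_le_one)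
      rw [isConnected_iff_connectedSpace]
      exact e.surjective.connectedSpace e.continuous
    refine ⟨hconn.nonempty, hconn, ?_⟩
    rw [isCompact_iff_compactSpace]
    exact e.compactSpace
  · rintro ⟨K, hK, hadj⟩
    have hδ : ∀ v w, ∃ δ > 0, v ≠ w → ¬ G.Adj v w →
        Disjoint (Metric.thickening δ (K v)) (Metric.thickening δ (K w)) := by
      intro v w
      by_cases h : v ≠ w ∧ ¬ G.Adj v w
      · have hd : Disjoint (K v) (K w) := by
          rw [Set.disjoint_iff_inter_eq_empty, ← Set.not_nonempty_iff_eq_empty, ← hadj v w h.1]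
          exact h.2
        obtain ⟨δ, h1, h2⟩ := hd.exists_thickenings (hK v).2.2 (hK w).2.2.isClosed
        exact ⟨δ, h1, fun _ _ => h2⟩
      · exact ⟨1, one_pos, fun h1 h2 => absurd ⟨h1, h2⟩ h⟩
    choose δ hδ0 hδ using hδ
    have hN : ∀ v, ∃ N : Set Plane, IsOpen N ∧ IsConnected N ∧ K v ⊆ N ∧
        ∀ w, N ⊆ Metric.thickening (δ v w) (K v) ∧ N ⊆ Metric.thickening (δ w v) (K v) := by
      intro v
      obtain ⟨x, hx⟩ := (hK v).1
      let T : Set Plane := ⋂ w, (Metric.thickening (δ v w) (K v) ∩ Metric.thickening (δ w v) (K v))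
      have hT : IsOpen T := isOpen_iInter_of_finite fun w =>
        Metric.isOpen_thickening.inter Metric.isOpen_thickening
      have hKT : K v ⊆ T := Set.subset_iInter fun w => Set.subset_inter
        (Metric.self_subset_thickening (hδ0 v w) _) (Metric.self_subset_thickening (hδ0 w v) _)
      refine ⟨connectedComponentIn T x, hT.connectedComponentIn,
        isConnected_connectedComponentIn_iff.2 (hKT hx),
        (hK v).2.1.isPreconnected.subset_connectedComponentIn hx hKT, fun w => ?_⟩
      have h1 : connectedComponentIn T x ⊆ _ :=
        (connectedComponentIn_subset T x).trans (Set.iInter_subset _ w)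
      exact ⟨h1.trans Set.inter_subset_left, h1.trans Set.inter_subset_right⟩
    choose N hNo hNc hKN hNT using hN
    have hp : ∀ e : Sym2 V, ∃ p : Plane, ∀ v w, e = s(v, w) → G.Adj v w → p ∈ K v ∧ p ∈ K w := by
      intro e
      induction e using Sym2.ind with
      | _ a b =>
        by_cases h : G.Adj a b
        · obtain ⟨p, hp⟩ := (hadj a b h.ne).1 h
          refine ⟨p, fun v w he _ => ?_⟩
          rcases Sym2.eq_iff.1 he with ⟨rfl, rfl⟩ | ⟨rfl, rfl⟩
          · exact hp
          · exact hp.symm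
        · refine ⟨0, fun v w he hvw => absurd ?_ h⟩
          rcases Sym2.eq_iff.1 he with ⟨rfl, rfl⟩ | ⟨rfl, rfl⟩
          · exact hvw
          · exact hvw.symm
    choose p hp using hp
    have hγ := fun v => arc_through (hNo v) (hNc v)
      ((Finset.univ.filter fun w => G.Adj v w).image fun w => p s(v, w)) (by
        intro z hz
        simp only [Finset.coe_image, Set.mem_image, Finset.coe_filter, Finset.mem_univ,
          true_and, Set.mem_ofPred_eq] at hz
        obtain ⟨w, hw, rfl⟩ := hz
        exact hKN v (hp _ v w rfl hw).1)
    choose γ h1 h2 h3 h4 using hγ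
    have hmem : ∀ v w, G.Adj v w → p s(v, w) ∈ Set.range (γ v) := by
      intro v w h
      apply h4 v
      simp only [Finset.coe_image, Set.mem_image, Finset.coe_filter, Finset.mem_univ,
          true_and, Set.mem_ofPred_eq]
      exact ⟨w, h, rfl⟩
    refine ⟨fun v => Set.range (γ v), fun v => ?_, fun v w hvw => ⟨fun h => ?_, fun h => ?_⟩⟩
    · exact ⟨((h1 v).isClosedEmbedding (h2 v)).isEmbedding.toHomeomorph⟩
    · refine ⟨p s(v, w), hmem v w h, ?_⟩
      rw [Sym2.eq_swap]
      exact hmem w v h.symm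
    · by_contra hn
      obtain ⟨z, hz1, hz2⟩ := h
      exact Set.disjoint_left.1 (hδ v w hvw hn) ((hNT v w).1 (h3 v hz1)) ((hNT w v).2 (h3 w hz2))
end
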